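/- (Gauge invariance of minimally coupled operators.) Suppose in addition that for each τ ∈ Δ^{p+1} there is a unitary representation T̃_τ : G → U(H) such that T̃_τ(g) Ũ_τ(ρ) = e^{−i ρ(g)} Ũ_τ(ρ) T̃_τ(g) for all g ∈ G, ρ ∈ Ĝ, while T̃_τ(g) commutes with every U_σ(g'), with every T̃_{τ'}(g''), and with every Ũ_{τ'}(ρ) for τ' ≠ τ. For φ' ∈ C^{p+1}(G) set T̃(φ') = ∏_{τ ∈ Δ^{p+1}} T̃_τ(φ'(τ)). Let O be a linear operator on H commuting with every T̃_τ(g) and every Ũ_τ(ρ). Then for every φ ∈ C^p(G) (not necessarily a cocycle), the gauge transformation U(φ) T̃(δφ) commutes with 𝒰 O 𝒰†: U(φ) T̃(δφ) · 𝒰 O 𝒰† = 𝒰 O 𝒰† · U(φ) T̃(δφ). -/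

import Mathlib

open Finset

set_option linter.unusedSectionVars false

noncomputable section

/-- The Pontryagin dual `Ĝ = Hom(G, ℝ/2πℤ)` of an abelian group `G`,
where `ℝ/2πℤ` is `Real.Angle = AddCircle (2π)`. -/
abbrev PDual (G : Type) [AddCommGroup G] : Type := G →+ Real.Angle

/-- The dual of a finite abelian group is finite (hence all the `∑ᶠ` sums over
(subsets of) chain groups with coefficients in `PDual G` below are honest
finite sums). -/
instance PDual.finite (G : Type) [AddCommGroup G] [Fintype G] : Finite (PDual G) := by
  classical
  set n := Fintype.card G with hn
  have hn0 : 0 < n := Fintype.card_pos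
  haveI : Fact (0 < 2 * Real.pi) := ⟨by positivity⟩
  have hT0 : Set.Finite {θ : AddCircle (2 * Real.pi) | n • θ = 0} := by
    have hU : Set.Finite
        (⋃ d ∈ Finset.Icc 1 n, {θ : AddCircle (2 * Real.pi) | addOrderOf θ = d}) :=
      Set.Finite.biUnion (Finset.Icc 1 n).finite_toSet
        (fun d hd => AddCircle.finite_setOfPred_addOrderOf_eq (2 * Real.pi)
          (by simp only [Finset.coe_Icc, Set.mem_Icc] at hd; exact hd.1))
    refine hU.subset ?_
    intro θ hθ
    have hfin : IsOfFinAddOrder θ := by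
      rw [isOfFinAddOrder_iff_nsmul_eq_zero]
      exact ⟨n, hn0, hθ⟩
    have hdvd : addOrderOf θ ∣ n := addOrderOf_dvd_of_nsmul_eq_zero hθ
    have hpos : 0 < addOrderOf θ := hfin.addOrderOf_pos
    refine Set.mem_iUnion₂.mpr ⟨addOrderOf θ, ?_, rfl⟩
    simp only [Finset.mem_Icc]
    exact ⟨hpos, Nat.le_of_dvd hn0 hdvd⟩
  have hT : Set.Finite {θ : Real.Angle | n • θ = 0} := hT0
  haveI : Finite {θ : Real.Angle | n • θ = 0} := hT.to_subtype
  have hinj : Function.Injective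
      (fun (k : G →+ Real.Angle) (g : G) =>
        (⟨k g, by
          show n • k g = 0
          rw [← map_nsmul, card_nsmul_eq_zero, map_zero]⟩ :
          {θ : Real.Angle | n • θ = 0})) := by
    intro k₁ k₂ h
    ext g
    have := congrFun h g
    simpa [Subtype.ext_iff] using this
  exact Finite.of_injective _ hinj

/-- The well-defined complex exponential `e^{iθ} = cos θ + i sin θ` for `θ ∈ ℝ/2πℤ`. -/
def expA (θ : Real.Angle) : ℂ := Real.Angle.cos θ + Real.Angle.sin θ * Complex.I

variable {G : Type} [AddCommGroup G] [Fintype G]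

/-- The pairing `⟨k, φ⟩ = ∑_{σ ∈ Δ} k(σ)(φ(σ))` with values in `ℝ/2πℤ`. -/
def pairing {Δ : Type} [Fintype Δ] (k : Δ → PDual G) (φ : Δ → G) : Real.Angle :=
  ∑ σ, k σ (φ σ)

/-- The boundary map `∂`, `(∂k')(σ) = ∑_τ s(τ,σ) • k'(τ)`; its image is the
boundary group `B_p(Ĝ)` and its kernel the cycle group `Z_{p+1}(Ĝ)`. -/
def bd {A B : Type} [Fintype A] (s : A → B → ℤ) (k' : A → PDual G) : B → PDual G :=
  fun σ => ∑ τ, s τ σ • k' τ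

/-- The coboundary map `δ`, `(δφ)(τ) = ∑_σ s(τ,σ) • φ(σ)`; its kernel is the
cocycle group `Z^p(G)` and its image the coboundary group `B^{p+1}(G)`. -/
def cb {A B : Type} [Fintype B] (s : A → B → ℤ) (φ : B → G) : A → G :=
  fun τ => ∑ σ, s τ σ • φ σ

variable {H : Type} [NormedAddCommGroup H] [InnerProductSpace ℂ H]
  [FiniteDimensional ℂ H]

/-- The product of a pairwise-commuting finite family of operators. -/
def commProd {ι : Type} [Fintype ι] (f : ι → H →L[ℂ] H)
    (h : ∀ i j, Commute (f i) (f j)) : H →L[ℂ] H :=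
  Finset.univ.noncommProd f (fun a _ b _ _ => h a b)

variable {Δp Δp1 : Type} [Fintype Δp] [Fintype Δp1]

/-- `U(φ) = ∏_{σ ∈ Δ^p} U_σ(φ(σ))`. -/
def Uop (U : Δp → G → H →L[ℂ] H)
    (hU : ∀ σ σ' g g', Commute (U σ g) (U σ' g')) (φ : Δp → G) : H →L[ℂ] H :=
  commProd (fun σ => U σ (φ σ)) fun σ σ' => hU σ σ' _ _

/-- The local factor `|G|⁻¹ ∑_{g ∈ G} e^{−i k(σ)(g)} U_σ(g)` of `P(k)`. -/
def Pfactor (U : Δp → G → H →L[ℂ] H) (k : Δp → PDual G) (σ : Δp) : H →L[ℂ] H :=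
  (Fintype.card G : ℂ)⁻¹ • ∑ g : G, expA (-(k σ g)) • U σ g

theorem Pfactor_commute (U : Δp → G → H →L[ℂ] H)
    (hU : ∀ σ σ' g g', Commute (U σ g) (U σ' g')) (k : Δp → PDual G)
    (σ σ' : Δp) : Commute (Pfactor U k σ) (Pfactor U k σ') := by
  unfold Pfactor
  apply Commute.smul_left
  apply Commute.smul_right
  apply Commute.sum_left
  intro g _
  apply Commute.sum_right
  intro g' _
  exact ((hU σ σ' g g').smul_right _).smul_left _

/-- The projector `P(k) = ∏_{σ ∈ Δ^p} ( |G|⁻¹ ∑_{g ∈ G} e^{−i k(σ)(g)} U_σ(g) )`. -/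
def Pop (U : Δp → G → H →L[ℂ] H)
    (hU : ∀ σ σ' g g', Commute (U σ g) (U σ' g')) (k : Δp → PDual G) : H →L[ℂ] H :=
  commProd (Pfactor U k) (Pfactor_commute U hU k)

/-- `Ũ(k') = ∏_{τ ∈ Δ^{p+1}} Ũ_τ(k'(τ))`. -/
def Utop (Ut : Δp1 → PDual G → H →L[ℂ] H)
    (hUt : ∀ τ τ' ρ ρ', Commute (Ut τ ρ) (Ut τ' ρ')) (k' : Δp1 → PDual G) : H →L[ℂ] H :=
  commProd (fun τ => Ut τ (k' τ)) fun τ τ' => hUt τ τ' _ _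

/-- The minimal coupling operator `𝒰 = ∑_{k ∈ B_p(Ĝ)} P(k) Ũ(r(k))`, for a fixed
section `r` of the boundary map. -/
def MC (s : Δp1 → Δp → ℤ) (U : Δp → G → H →L[ℂ] H)
    (hU : ∀ σ σ' g g', Commute (U σ g) (U σ' g'))
    (Ut : Δp1 → PDual G → H →L[ℂ] H)
    (hUt : ∀ τ τ' ρ ρ', Commute (Ut τ ρ) (Ut τ' ρ'))
    (r : (Δp → PDual G) → (Δp1 → PDual G)) : H →L[ℂ] H :=
  ∑ᶠ k ∈ Set.range (bd (G := G) s), Pop U hU k * Utop Ut hUt (r k)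

/-- `T̃(φ') = ∏_{τ ∈ Δ^{p+1}} T̃_τ(φ'(τ))`. -/
def Ttop (T : Δp1 → G → H →L[ℂ] H)
    (hT : ∀ τ τ' g g', Commute (T τ g) (T τ' g')) (φ' : Δp1 → G) : H →L[ℂ] H :=
  commProd (fun τ => T τ (φ' τ)) fun τ τ' => hT τ τ' _ _

theorem expA_add' (a b : Real.Angle) : expA (a + b) = expA a * expA b := by
  unfold expA
  rw [Real.Angle.cos_add, Real.Angle.sin_add]
  push_cast
  linear_combination (-(Real.Angle.sin a : ℂ) * Real.Angle.sin b) * Complex.I_sq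

theorem expA_zero' : expA 0 = 1 := by
  simp [expA]

theorem expA_sum' {ι : Type} (t : Finset ι) (f : ι → Real.Angle) :
    expA (∑ i ∈ t, f i) = ∏ i ∈ t, expA (f i) := by
  classical
  induction t using Finset.induction_on with
  | empty => simp [expA_zero']
  | insert a t ha ih => rw [Finset.sum_insert ha, Finset.prod_insert ha, expA_add', ih]

theorem noncommProd_smul' {ι : Type} (t : Finset ι) (c : ι → ℂ) (f : ι → H →L[ℂ] H)
    (h : (t : Set ι).Pairwise (Function.onFun Commute f))
    (h' : (t : Set ι).Pairwise (Function.onFun Commute (fun i => c i • f i))) :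
    t.noncommProd (fun i => c i • f i) h' = (∏ i ∈ t, c i) • t.noncommProd f h := by
  classical
  induction t using Finset.induction_on with
  | empty => simp
  | insert a t ha ih =>
    rw [Finset.noncommProd_insert_of_notMem _ _ _ _ ha,
      Finset.noncommProd_insert_of_notMem _ _ _ _ ha, Finset.prod_insert ha, ih,
      smul_mul_smul_comm]

theorem commProd_commute' {ι : Type} [Fintype ι] (f : ι → H →L[ℂ] H)
    (h : ∀ i j, Commute (f i) (f j)) (x : H →L[ℂ] H) (hx : ∀ i, Commute x (f i)) :
    Commute x (commProd f h) :=
  Finset.noncommProd_commute _ _ _ _ (fun i _ => hx i)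

theorem commProd_unitary' {ι : Type} [Fintype ι] (f : ι → H →L[ℂ] H)
    (h : ∀ i j, Commute (f i) (f j)) (hf : ∀ i, f i ∈ unitary (H →L[ℂ] H)) :
    commProd f h ∈ unitary (H →L[ℂ] H) :=
  Submonoid.noncommProd_mem _ _ _ _ (fun i _ => hf i)

/-- Twisted exchange of two commuting products. -/
theorem commProd_exchange' {ι : Type} [Fintype ι] (f g : ι → H →L[ℂ] H) (c : ι → ℂ)
    (hf : ∀ i j, Commute (f i) (f j)) (hg : ∀ i j, Commute (g i) (g j))
    (hfg : ∀ i j, i ≠ j → Commute (f i) (g j))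
    (hc : ∀ i, f i * g i = c i • (g i * f i)) :
    commProd f hf * commProd g hg = (∏ i, c i) • (commProd g hg * commProd f hf) := by
  have hgf : ∀ i j, Commute ((g * f) i) ((g * f) j) := by
    intro i j
    by_cases hij : i = j
    · subst hij; exact Commute.refl _
    · exact ((hg i j).mul_right (hfg j i (Ne.symm hij)).symm).mul_left
        ((hfg i j hij).mul_right (hf i j))
  have e1 := Finset.noncommProd_mul_distrib (s := Finset.univ) f g
    (fun a _ b _ _ => hf a b) (fun a _ b _ _ => hg a b)
    (fun a _ b _ hab => (hfg b a (Ne.symm hab)).symm)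
  have e2 := Finset.noncommProd_mul_distrib (s := Finset.univ) g f
    (fun a _ b _ _ => hg a b) (fun a _ b _ _ => hf a b)
    (fun a _ b _ hab => hfg a b hab)
  have e3 := noncommProd_smul' Finset.univ c (g * f) (fun i _ j _ _ => hgf i j)
    (fun i _ j _ _ => ((hgf i j).smul_right _).smul_left _)
  unfold commProd
  rw [← e1, ← e2, ← e3]
  exact Finset.noncommProd_congr rfl (fun i _ => hc i) _

/-- `f` acts by scalars on `g`. -/
theorem commProd_absorb' {ι : Type} [Fintype ι] (f g : ι → H →L[ℂ] H) (c : ι → ℂ)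
    (hf : ∀ i j, Commute (f i) (f j)) (hg : ∀ i j, Commute (g i) (g j))
    (hfg : ∀ i j, Commute (f i) (g j))
    (hc : ∀ i, f i * g i = c i • g i) :
    commProd f hf * commProd g hg = (∏ i, c i) • commProd g hg := by
  have e1 := Finset.noncommProd_mul_distrib (s := Finset.univ) f g
    (fun a _ b _ _ => hf a b) (fun a _ b _ _ => hg a b)
    (fun a _ b _ _ => (hfg b a).symm)
  have e3 := noncommProd_smul' Finset.univ c g (fun i _ j _ _ => hg i j)
    (fun i _ j _ _ => ((hg i j).smul_right _).smul_left _)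
  unfold commProd
  rw [← e1, ← e3]
  exact Finset.noncommProd_congr rfl (fun i _ => hc i) _

theorem commute_Pfactor' (U : Δp → G → H →L[ℂ] H) (k : Δp → PDual G) (σ : Δp)
    (x : H →L[ℂ] H) (hx : ∀ g, Commute x (U σ g)) : Commute x (Pfactor U k σ) := by
  unfold Pfactor
  apply Commute.smul_right
  apply Commute.sum_right
  intro g _
  exact (hx g).smul_right _

theorem U_mul_Pfactor' (U : Δp → G → H →L[ℂ] H)
    (hUhom : ∀ σ g g', U σ (g + g') = U σ g * U σ g')
    (k : Δp → PDual G) (σ : Δp) (g : G) :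
    U σ g * Pfactor U k σ = expA (k σ g) • Pfactor U k σ := by
  unfold Pfactor
  rw [mul_smul_comm, smul_comm (expA (k σ g))]
  congr 1
  rw [Finset.mul_sum, Finset.smul_sum]
  rw [← Equiv.sum_comp (Equiv.addLeft g)
    (fun x => expA (k σ g) • expA (-(k σ x)) • U σ x)]
  refine Finset.sum_congr rfl fun x _ => ?_
  rw [mul_smul_comm, Equiv.coe_addLeft, hUhom, smul_smul, ← expA_add']
  congr 2
  rw [map_add]
  abel

theorem pairing_adj' (s : Δp1 → Δp → ℤ) (k' : Δp1 → PDual G) (φ : Δp → G) :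
    ∑ τ, k' τ (cb s φ τ) = ∑ σ, bd s k' σ (φ σ) := by
  simp only [cb, bd, map_sum, map_zsmul, AddMonoidHom.finsetSum_apply, AddMonoidHom.smul_apply]
  exact Finset.sum_comm

/-- **Gauge invariance of minimally coupled operators**: if each `T̃_τ` is a
unitary representation of `G` with `T̃_τ(g) Ũ_τ(ρ) = e^{−iρ(g)} Ũ_τ(ρ) T̃_τ(g)`,
`T̃_τ(g)` commuting with every `U_σ(g')`, every `T̃_{τ'}(g'')` and every
`Ũ_{τ'}(ρ)` for `τ' ≠ τ`, and `O` commutes with every `T̃_τ(g)` and every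
`Ũ_τ(ρ)`, then for every `φ ∈ C^p(G)` (not necessarily a cocycle) the gauge
transformation `U(φ) T̃(δφ)` commutes with `𝒰 O 𝒰†`. -/
theorem gauge_invariance_of_minimally_coupled
    (s : Δp1 → Δp → ℤ)
    (U : Δp → G → H →L[ℂ] H)
    (hU : ∀ σ σ' g g', Commute (U σ g) (U σ' g'))
    (hUhom : ∀ σ g g', U σ (g + g') = U σ g * U σ g')
    (hU0 : ∀ σ, U σ 0 = 1)
    (hUunit : ∀ σ g, star (U σ g) * U σ g = 1 ∧ U σ g * star (U σ g) = 1)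
    (Ut : Δp1 → PDual G → H →L[ℂ] H)
    (hUt : ∀ τ τ' ρ ρ', Commute (Ut τ ρ) (Ut τ' ρ'))
    (hUthom : ∀ τ ρ ρ', Ut τ (ρ + ρ') = Ut τ ρ * Ut τ ρ')
    (hUt0 : ∀ τ, Ut τ 0 = 1)
    (hUtunit : ∀ τ ρ, star (Ut τ ρ) * Ut τ ρ = 1 ∧ Ut τ ρ * star (Ut τ ρ) = 1)
    (hmix : ∀ σ τ g ρ, Commute (U σ g) (Ut τ ρ))
    (T : Δp1 → G → H →L[ℂ] H)
    (hTT : ∀ τ τ' g g', Commute (T τ g) (T τ' g'))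
    (hThom : ∀ τ g g', T τ (g + g') = T τ g * T τ g')
    (hT0 : ∀ τ, T τ 0 = 1)
    (hTunit : ∀ τ g, star (T τ g) * T τ g = 1 ∧ T τ g * star (T τ g) = 1)
    (hTU : ∀ τ g ρ, T τ g * Ut τ ρ = expA (-(ρ g)) • (Ut τ ρ * T τ g))
    (hTmat : ∀ τ g σ g', Commute (T τ g) (U σ g'))
    (hTUt : ∀ τ τ', τ ≠ τ' → ∀ g ρ, Commute (T τ g) (Ut τ' ρ))
    (r : (Δp → PDual G) → (Δp1 → PDual G))
    (hr : ∀ k ∈ Set.range (bd (G := G) s), bd s (r k) = k)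
    (O : H →L[ℂ] H)
    (hOT : ∀ τ g, Commute O (T τ g))
    (hOU : ∀ τ ρ, Commute O (Ut τ ρ))
    (φ : Δp → G) :
    (Uop U hU φ * Ttop T hTT (cb s φ))
        * (MC s U hU Ut hUt r * O * star (MC s U hU Ut hUt r))
      = (MC s U hU Ut hUt r * O * star (MC s U hU Ut hUt r))
        * (Uop U hU φ * Ttop T hTT (cb s φ)) := by
  set W := Ttop T hTT (cb s φ) with hW
  set V := Uop U hU φ with hV
  set M := MC s U hU Ut hUt r with hM
  have hWu : W ∈ unitary (H →L[ℂ] H) :=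
    commProd_unitary' _ _ (fun τ => Unitary.mem_iff.2 (hTunit τ _))
  have hVu : V ∈ unitary (H →L[ℂ] H) :=
    commProd_unitary' _ _ (fun σ => Unitary.mem_iff.2 (hUunit σ _))
  have hVWu : V * W ∈ unitary (H →L[ℂ] H) := mul_mem hVu hWu
  have hOW : Commute O W := commProd_commute' _ _ _ (fun τ => hOT τ _)
  have hterm : ∀ k ∈ Set.range (bd (G := G) s),
      (V * W) * (Pop U hU k * Utop Ut hUt (r k)) = (Pop U hU k * Utop Ut hUt (r k)) * W := by
    intro k hk
    have hWP : Commute W (Pop U hU k) :=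
      commProd_commute' _ _ _ fun σ => commute_Pfactor' U k σ W fun g =>
        (commProd_commute' _ _ _ fun τ => (hTmat τ _ σ g).symm).symm
    have h1 : V * Pop U hU k = (∏ σ, expA (k σ (φ σ))) • Pop U hU k :=
      commProd_absorb' _ _ _ _ _
        (fun i j => commute_Pfactor' U k j _ fun g => hU i j _ g)
        (fun σ => U_mul_Pfactor' U hUhom k σ _)
    have h2 : W * Utop Ut hUt (r k)
        = (∏ τ, expA (-(r k τ (cb s φ τ)))) • (Utop Ut hUt (r k) * W) :=
      commProd_exchange' _ _ _ _ _ (fun i j hij => hTUt i j hij _ _) (fun τ => hTU τ _ _)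
    have h3 : (∏ σ, expA (k σ (φ σ))) * (∏ τ, expA (-(r k τ (cb s φ τ)))) = 1 := by
      rw [← expA_sum', ← expA_sum', ← expA_add', Finset.sum_neg_distrib, pairing_adj', hr k hk,
        add_neg_cancel, expA_zero']
    calc (V * W) * (Pop U hU k * Utop Ut hUt (r k))
        = V * (W * Pop U hU k) * Utop Ut hUt (r k) := by simp only [mul_assoc]
      _ = (V * Pop U hU k) * (W * Utop Ut hUt (r k)) := by rw [hWP.eq]; simp only [mul_assoc]
      _ = _ := by rw [h1, h2, smul_mul_smul_comm, h3, one_smul, mul_assoc]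
  have hVM : (V * W) * M = M * W := by
    have hfin : (Set.range (bd (A := Δp1) (B := Δp) (G := G) s)).Finite := Set.toFinite _
    rw [hM]
    unfold MC
    rw [finsum_mem_eq_finite_toFinset_sum _ hfin, Finset.mul_sum, Finset.sum_mul]
    exact Finset.sum_congr rfl fun k hk => hterm k (hfin.mem_toFinset.1 hk)
  have hMs : W * star M = star M * (V * W) := by
    have h := congrArg star hVM
    rw [star_mul, star_mul M W] at h
    have h5 : W * star W = 1 := (Unitary.mem_iff.1 hWu).2
    have h6 : star (V * W) * (V * W) = 1 := (Unitary.mem_iff.1 hVWu).1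
    calc W * star M = W * (star M * (star (V * W) * (V * W))) := by rw [h6, mul_one]
      _ = W * (star M * star (V * W)) * (V * W) := by simp only [mul_assoc]
      _ = (W * star W) * (star M * (V * W)) := by rw [h]; simp only [mul_assoc]
      _ = _ := by rw [h5, one_mul]
  calc (V * W) * (M * O * star M) = ((V * W) * M) * O * star M := by simp only [mul_assoc]
    _ = M * (O * W) * star M := by rw [hVM, hOW.eq]; simp only [mul_assoc]
    _ = M * O * (W * star M) := by simp only [mul_assoc]
    _ = _ := by rw [hMs]; simp only [mul_assoc]
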